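/- arXiv:0809.3365 — 3 statements merged into one kernel-verified Lean document; each statement's English description precedes it below -/
import Mathlib

section
/- If U ∈ O is a unit of O (i.e., there exists V ∈ O with UV = VU = I), then det U ∈ {1, −1, i, −i}. Moreover every one of these four values is attained by a unit of O: det I = 1, det(diag(θ, θ̄)) = −1, det([[0,1],[i,0]]) = −i, and det(diag(θ, θ̄)·[[0,1],[i,0]]) = i. Consequently the reduced norm (determinant) map from the unit group O* onto {1,−1,i,−i} is a surjective group homomorphism with kernel O¹, so O¹ is a normal subgroup of index 4 in O*. -/
open Complex Matrix

/-- The golden ratio `θ = (1+√5)/2`. -/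
noncomputable def gr : ℝ := (1 + Real.sqrt 5) / 2

/-- A generic element `a + b·i + c·θ + d·i·θ` of `R = ℤ[i,θ] ⊂ ℂ`. -/
noncomputable def gold (a b c d : ℤ) : ℂ := a + b * I + c * (gr : ℂ) + d * I * (gr : ℂ)

/-- Its conjugate `σ(a + b·i + c·θ + d·i·θ) = a + b·i + c·θ̄ + d·i·θ̄` with `θ̄ = 1 - θ`. -/
noncomputable def goldBar (a b c d : ℤ) : ℂ :=
  a + b * I + c * (1 - (gr : ℂ)) + d * I * (1 - (gr : ℂ))

/-- The matrix `[[x₁, x₂],[i·σ(x₂), σ(x₁)]]` with `x₁ = a+bi+cθ+diθ`, `x₂ = e+fi+gθ+hiθ`. -/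
noncomputable def Omat (a b c d e f g h : ℤ) : Matrix (Fin 2) (Fin 2) ℂ :=
  !![gold a b c d, gold e f g h; I * goldBar e f g h, goldBar a b c d]

/-- The maximal order `O` of the Golden Code algebra. -/
def Oset : Set (Matrix (Fin 2) (Fin 2) ℂ) :=
  { M | ∃ a b c d e f g h : ℤ, M = Omat a b c d e f g h }


/-- `O¹`, the set of elements of `O` of determinant (reduced norm) one. -/
def O1 : Set (Matrix (Fin 2) (Fin 2) ℂ) := { M | M ∈ Oset ∧ M.det = 1 }

/-- The matrix `diag(θ, θ̄)`. -/
noncomputable def dTheta : Matrix (Fin 2) (Fin 2) ℂ := !![(gr : ℂ), 0; 0, 1 - (gr : ℂ)]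

/-- The matrix `j = [[0,1],[i,0]]`. -/
noncomputable def jmat : Matrix (Fin 2) (Fin 2) ℂ := !![0, 1; I, 0]

lemma gr_sq : (gr : ℂ) * gr = gr + 1 := by
  have h : gr * gr = gr + 1 := by
    have h5 : Real.sqrt 5 * Real.sqrt 5 = 5 := Real.mul_self_sqrt (by norm_num)
    unfold gr
    linear_combination h5 / 4
  exact_mod_cast h

/-- pairs `(x, σ x)` -/
def Pr (x y : ℂ) : Prop := ∃ a b c d : ℤ, x = gold a b c d ∧ y = goldBar a b c d

lemma Pr.add {x y x' y' : ℂ} (h : Pr x y) (h' : Pr x' y') : Pr (x + x') (y + y') := by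
  obtain ⟨a, b, c, d, rfl, rfl⟩ := h
  obtain ⟨e, f, g, k, rfl, rfl⟩ := h'
  refine ⟨a + e, b + f, c + g, d + k, ?_, ?_⟩ <;> simp only [gold, goldBar] <;> push_cast <;> ring

lemma Pr.swap {x y : ℂ} (h : Pr x y) : Pr y x := by
  obtain ⟨a, b, c, d, rfl, rfl⟩ := h
  refine ⟨a + c, b + d, -c, -d, ?_, ?_⟩ <;> simp only [gold, goldBar] <;> push_cast <;> ring

lemma Pr.mulI {x y : ℂ} (h : Pr x y) : Pr (I * x) (I * y) := by
  obtain ⟨a, b, c, d, rfl, rfl⟩ := h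
  refine ⟨-b, a, -d, c, ?_, ?_⟩ <;> simp only [gold, goldBar] <;> push_cast
  · linear_combination (b + d * (gr : ℂ)) * I_mul_I
  · linear_combination (b + d * (1 - (gr : ℂ))) * I_mul_I

lemma Pr.mul {x y x' y' : ℂ} (h : Pr x y) (h' : Pr x' y') : Pr (x * x') (y * y') := by
  obtain ⟨a, b, c, d, rfl, rfl⟩ := h
  obtain ⟨e, f, g, k, rfl, rfl⟩ := h'
  refine ⟨a*e - b*f + (c*g - d*k), a*f + b*e + (c*k + d*g),
    a*g - b*k + (c*e - d*f) + (c*g - d*k), a*k + b*g + (c*f + d*e) + (c*k + d*g), ?_, ?_⟩ <;>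
  simp only [gold, goldBar] <;> push_cast
  · linear_combination (b*f + b*k*(gr:ℂ) + d*f*gr + d*k*(gr + 1)) * I_mul_I +
      (c + d*I)*(g + k*I) * gr_sq
  · linear_combination (b*f + b*k*(1-(gr:ℂ)) + d*f*(1-gr) + d*k*(1 - gr + 1)) * I_mul_I +
      (c + d*I)*(g + k*I) * gr_sq

lemma mem_Oset_iff (M : Matrix (Fin 2) (Fin 2) ℂ) :
    M ∈ Oset ↔ ∃ x x' y y' : ℂ, Pr x x' ∧ Pr y y' ∧ M = !![x, y; I * y', x'] := by
  constructor
  · rintro ⟨a, b, c, d, e, f, g, h, rfl⟩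
    exact ⟨_, _, _, _, ⟨a, b, c, d, rfl, rfl⟩, ⟨e, f, g, h, rfl, rfl⟩, rfl⟩
  · rintro ⟨_, _, _, _, ⟨a, b, c, d, rfl, rfl⟩, ⟨e, f, g, h, rfl, rfl⟩, rfl⟩
    exact ⟨a, b, c, d, e, f, g, h, rfl⟩

lemma Oset_mul {M N : Matrix (Fin 2) (Fin 2) ℂ} (hM : M ∈ Oset) (hN : N ∈ Oset) :
    M * N ∈ Oset := by
  rw [mem_Oset_iff] at *
  obtain ⟨x, x', y, y', hx, hy, rfl⟩ := hM
  obtain ⟨z, z', w, w', hz, hw, rfl⟩ := hN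
  refine ⟨_, _, _, _, (hx.mul hz).add (hy.mul hw.swap.mulI), (hx.mul hw).add (hy.mul hz.swap), ?_⟩
  rw [Matrix.mul_fin_two]
  congr! 2
  ext i j
  fin_cases i <;> fin_cases j <;> simp <;> ring

lemma Oset_det {M : Matrix (Fin 2) (Fin 2) ℂ} (hM : M ∈ Oset) :
    ∃ p q : ℤ, M.det = p + q * I := by
  obtain ⟨a, b, c, d, e, f, g, h, rfl⟩ := hM
  refine ⟨a*a-b*b+(a*c-b*d)-(c*c-d*d)+(2*e*f+e*h+f*g-2*g*h),
    2*a*b+a*d+b*c-2*c*d-(e*e-f*f+(e*g-f*h)-(g*g-h*h)), ?_⟩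
  simp only [Omat, Matrix.det_fin_two_of, gold, goldBar]
  push_cast
  linear_combination (b*b+b*d-d*d-(2*e*f+e*h+f*g-2*g*h) - I*(f*f+f*h-h*h) : ℂ) * I_mul_I
    - ((c+d*I)*(c+d*I) - I*((g+h*I)*(g+h*I))) * gr_sq

lemma unit_det {U V : Matrix (Fin 2) (Fin 2) ℂ} (hU : U ∈ Oset) (hV : V ∈ Oset)
    (h : U * V = 1) : U.det ∈ ({1, -1, I, -I} : Set ℂ) := by
  obtain ⟨p, q, hp⟩ := Oset_det hU
  obtain ⟨r, s, hr⟩ := Oset_det hV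
  have h1 : U.det * V.det = 1 := by rw [← Matrix.det_mul, h, Matrix.det_one]
  rw [hp, hr] at h1
  have hre := congrArg Complex.re h1
  have him := congrArg Complex.im h1
  simp at hre him
  have hre' : p * r - q * s = 1 := by exact_mod_cast hre
  have him' : p * s + q * r = 0 := by exact_mod_cast him
  have hn : (p*p + q*q) * (r*r+s*s) = 1 := by
    linear_combination (p*r-q*s+1) * hre' + (p*s+q*r) * him'
  have h2 : p*p+q*q = 1 := by
    rcases Int.eq_one_or_neg_one_of_mul_eq_one hn with h | h
    · exact h
    · nlinarith [mul_self_nonneg p, mul_self_nonneg q]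
  have p1 : p ≤ 1 := by nlinarith
  have p2 : -1 ≤ p := by nlinarith
  have q1 : q ≤ 1 := by nlinarith
  have q2 : -1 ≤ q := by nlinarith
  rw [hp]
  interval_cases p <;> interval_cases q <;> simp at h2 ⊢

lemma one_mem_O : (1 : Matrix (Fin 2) (Fin 2) ℂ) ∈ Oset :=
  ⟨1, 0, 0, 0, 0, 0, 0, 0, by simp [Omat, gold, goldBar, Matrix.one_fin_two]⟩

lemma dTheta_mem : dTheta ∈ Oset :=
  ⟨0, 0, 1, 0, 0, 0, 0, 0, by simp [Omat, gold, goldBar, dTheta]⟩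

lemma jmat_mem : jmat ∈ Oset :=
  ⟨0, 0, 0, 0, 1, 0, 0, 0, by simp [Omat, gold, goldBar, jmat]⟩

lemma dTheta_det : dTheta.det = -1 := by
  simp only [dTheta, Matrix.det_fin_two_of]
  linear_combination -gr_sq

lemma jmat_det : jmat.det = -I := by simp [jmat, Matrix.det_fin_two_of]

lemma dTheta_inv : ∃ V ∈ Oset, dTheta * V = 1 ∧ V * dTheta = 1 := by
  have h : dTheta * Omat (-1) 0 1 0 0 0 0 0 = 1 := by
    simp only [dTheta, Omat, gold, goldBar, Matrix.mul_fin_two, Matrix.one_fin_two]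
    ext i j
    fin_cases i <;> fin_cases j <;> simp <;> linear_combination gr_sq
  exact ⟨_, ⟨_, _, _, _, _, _, _, _, rfl⟩, h, mul_eq_one_comm.mp h⟩

lemma jmat_inv : ∃ V ∈ Oset, jmat * V = 1 ∧ V * jmat = 1 := by
  have h : jmat * Omat 0 0 0 0 0 (-1) 0 0 = 1 := by
    simp only [jmat, Omat, gold, goldBar, Matrix.mul_fin_two, Matrix.one_fin_two]
    ext i j
    fin_cases i <;> fin_cases j <;> simp
  exact ⟨_, ⟨_, _, _, _, _, _, _, _, rfl⟩, h, mul_eq_one_comm.mp h⟩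

/-- If `U ∈ O` is a unit of `O` then `det U ∈ {1,−1,i,−i}`; each of these four values is
attained by a unit of `O` (namely `I`, `diag(θ,θ̄)`, `j = [[0,1],[i,0]]` and `diag(θ,θ̄)·j`);
consequently the determinant (reduced norm) is a surjective homomorphism from the unit group
`O*` onto `{1,−1,i,−i}` with kernel `O¹`, so `O¹` is a normal subgroup of index 4 of `O*`:
a unit lies in `O¹` iff its determinant is `1`, `O¹` is stable under conjugation by units of
`O`, and two units lie in the same left coset of `O¹` iff they have the same determinant. -/
theorem det_units_of_order :
    (∀ U ∈ Oset, (∃ V ∈ Oset, U * V = 1 ∧ V * U = 1) →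
      U.det ∈ ({1, -1, I, -I} : Set ℂ)) ∧
    ((1 : Matrix (Fin 2) (Fin 2) ℂ) ∈ Oset ∧
      (∃ V ∈ Oset, (1 : Matrix (Fin 2) (Fin 2) ℂ) * V = 1 ∧
        V * (1 : Matrix (Fin 2) (Fin 2) ℂ) = 1) ∧
      Matrix.det (1 : Matrix (Fin 2) (Fin 2) ℂ) = 1) ∧
    (dTheta ∈ Oset ∧ (∃ V ∈ Oset, dTheta * V = 1 ∧ V * dTheta = 1) ∧ dTheta.det = -1) ∧
    (jmat ∈ Oset ∧ (∃ V ∈ Oset, jmat * V = 1 ∧ V * jmat = 1) ∧ jmat.det = -I) ∧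
    (dTheta * jmat ∈ Oset ∧ (∃ V ∈ Oset, (dTheta * jmat) * V = 1 ∧ V * (dTheta * jmat) = 1) ∧
      (dTheta * jmat).det = I) ∧
    (∀ U ∈ Oset, (∃ V ∈ Oset, U * V = 1 ∧ V * U = 1) → (U ∈ O1 ↔ U.det = 1)) ∧
    (∀ U V : Matrix (Fin 2) (Fin 2) ℂ, U ∈ Oset → V ∈ Oset → U * V = 1 → V * U = 1 →
      ∀ W ∈ O1, U * W * V ∈ O1) ∧
    (∀ U₁ V₁ U₂ V₂ : Matrix (Fin 2) (Fin 2) ℂ,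
      U₁ ∈ Oset → V₁ ∈ Oset → U₁ * V₁ = 1 → V₁ * U₁ = 1 →
      U₂ ∈ Oset → V₂ ∈ Oset → U₂ * V₂ = 1 → V₂ * U₂ = 1 →
      (U₁.det = U₂.det ↔ ∃ W ∈ O1, U₁ = U₂ * W)) := by
  refine ⟨?_, ⟨one_mem_O, ⟨1, one_mem_O, by simp, by simp⟩, Matrix.det_one⟩,
    ⟨dTheta_mem, dTheta_inv, dTheta_det⟩, ⟨jmat_mem, jmat_inv, jmat_det⟩,
    ⟨Oset_mul dTheta_mem jmat_mem, ?_, ?_⟩, ?_, ?_, ?_⟩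
  · rintro U hU ⟨V, hV, h, -⟩
    exact unit_det hU hV h
  · obtain ⟨A, hA, hA1, -⟩ := dTheta_inv
    obtain ⟨B, hB, hB1, -⟩ := jmat_inv
    have h : (dTheta * jmat) * (B * A) = 1 := by
      rw [Matrix.mul_assoc, ← Matrix.mul_assoc jmat, hB1, Matrix.one_mul, hA1]
    exact ⟨B * A, Oset_mul hB hA, h, mul_eq_one_comm.mp h⟩
  · rw [Matrix.det_mul, dTheta_det, jmat_det]; ring
  · intro U hU _
    exact ⟨fun h => h.2, fun h => ⟨hU, h⟩⟩
  · intro U V hU hV h _ W hW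
    refine ⟨Oset_mul (Oset_mul hU hW.1) hV, ?_⟩
    rw [Matrix.det_mul, Matrix.det_mul, hW.2, mul_one, ← Matrix.det_mul, h, Matrix.det_one]
  · intro U₁ V₁ U₂ V₂ hU₁ _ _ _ _ hV₂ h h'
    constructor
    · intro hd
      refine ⟨V₂ * U₁, ⟨Oset_mul hV₂ hU₁, ?_⟩, ?_⟩
      · rw [Matrix.det_mul, hd, ← Matrix.det_mul, h', Matrix.det_one]
      · rw [← Matrix.mul_assoc, h, Matrix.one_mul]
    · rintro ⟨W, hW, rfl⟩
      rw [Matrix.det_mul, hW.2, mul_one]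
end

section
/- If U ∈ O¹ is a unitary matrix (i.e., U·U^H = I, where U^H is the conjugate transpose), then U = I or U = −I. Equivalently, since the stabilizer of the point J = (0,1) under the action of SL₂(ℂ) on hyperbolic upper half-space is SU(2), no nontrivial element of O¹/{±I} fixes J. -/
open Complex Matrix

/-- If `U ∈ O¹` is unitary (`U·Uᴴ = I`) then `U = I` or `U = −I`: no nontrivial element of
`O¹/{±I}` fixes the point `J = (0,1)` (whose stabilizer in `SL₂(ℂ)` is `SU(2)`). -/
theorem unitary_of_O1 (U : Matrix (Fin 2) (Fin 2) ℂ) (hU : U ∈ O1)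
    (hunitary : U * Uᴴ = 1) : U = 1 ∨ U = -1 := by
  obtain ⟨⟨a, b, c, d, e, f, g, h, hM⟩, hdet⟩ := hU
  have hadj : Uᴴ = U.adjugate := by
    have h1 : U.adjugate * (U * Uᴴ) = U.adjugate := by rw [hunitary, mul_one]
    rw [← mul_assoc, adjugate_mul, hdet, one_smul, one_mul] at h1
    exact h1
  have hirr : Irrational gr := Real.goldenRatio_irrational
  have hsq : gr ^ 2 = gr + 1 := Real.goldenRatio_sq
  have h00 := congrFun (congrFun hadj 0) 0
  have h01 := congrFun (congrFun hadj 0) 1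
  have hu := congrFun (congrFun hunitary 0) 0
  rw [hM] at h00 h01 hu
  simp [Omat, adjugate_fin_two, Matrix.mul_apply, Fin.sum_univ_two, gold, goldBar] at h00 h01 hu
  have r00 := congrArg Complex.re h00
  have i00 := congrArg Complex.im h00
  have r01 := congrArg Complex.re h01
  have ru := congrArg Complex.re hu
  simp at r00 i00 r01 ru
  have hc : c = 0 := by
    by_contra hc
    have : gr = 1 - gr := r00.resolve_right hc
    nlinarith
  have hd : d = -2 * b := by
    have : (d : ℝ) = -2 * b := by linarith
    exact_mod_cast this
  have key : ((g + h : ℤ) : ℝ) * gr = ((f + h - e : ℤ) : ℝ) := by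
    push_cast; linarith
  have hgh : g + h = 0 := by
    by_contra hne
    have hne' : ((g + h : ℤ) : ℝ) ≠ 0 := by exact_mod_cast hne
    exact (hirr.intCast_mul hne).ne_int _ key
  have hf : f = e - h := by
    rw [hgh] at key
    have : (0 : ℤ) = f + h - e := by
      have : ((0 : ℤ) : ℝ) = ((f + h - e : ℤ) : ℝ) := by rw [← key]; simp
      exact_mod_cast this
    omega
  obtain rfl : h = -g := by omega
  subst hc hd hf
  have hn : a ^ 2 + 5 * b ^ 2 + 2 * e ^ 2 + 2 * e * g + 3 * g ^ 2 = 1 := by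
    have : (a : ℝ) ^ 2 + 5 * b ^ 2 + 2 * e ^ 2 + 2 * e * g + 3 * g ^ 2 = 1 := by
      push_cast at ru
      rw [← ru]
      linear_combination (-4 * (b : ℝ) ^ 2 - 2 * g ^ 2) * hsq
    exact_mod_cast this
  have hb : b = 0 := by
    by_contra hb
    have : 0 < b ^ 2 := by positivity
    nlinarith [sq_nonneg a, sq_nonneg e, sq_nonneg (e + g), sq_nonneg g]
  have hg : g = 0 := by
    by_contra hb
    have : 0 < g ^ 2 := by positivity
    nlinarith [sq_nonneg a, sq_nonneg e, sq_nonneg (e + g), sq_nonneg b]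
  subst hb hg
  have he : e = 0 := by
    by_contra hb
    have : 0 < e ^ 2 := by positivity
    nlinarith [sq_nonneg a]
  subst he
  have ha : a = 1 ∨ a = -1 := by
    have : a ^ 2 = 1 := by linarith
    exact by simpa using this
  rw [hM]
  rcases ha with rfl | rfl
  · left
    ext i j
    fin_cases i <;> fin_cases j <;> simp [Omat, gold, goldBar]
  · right
    ext i j
    fin_cases i <;> fin_cases j <;> simp [Omat, gold, goldBar]
end

section
/- There exists a constant C > 0 such that for every γ ≥ 1, ∫₀^∞ ( (z/4)·∫₀^∞ e^{−z²/(2u) − u/2} du ) · e^{−γz} dz ≤ C/γ². (This says that the Laplace transform of the density of Z = 2|det H| decays like γ^{−2}, which is the analytic content of the statement that algebraic reduction followed by zero-forcing detection achieves diversity order 2 on the 2×2 Rayleigh channel.) -/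
open MeasureTheory

/-- There is a constant `C > 0` such that for every `γ ≥ 1`,
`∫₀^∞ ((z/4)·∫₀^∞ e^{−z²/(2u) − u/2} du)·e^{−γz} dz ≤ C/γ²`: the Laplace transform of the
density of `Z = 2|det H|` decays like `γ⁻²` (diversity order 2). -/
theorem laplace_transform_decay :
    ∃ C : ℝ, 0 < C ∧ ∀ γ : ℝ, 1 ≤ γ →
      (∫ z in Set.Ioi (0 : ℝ),
        ((z / 4) * ∫ u in Set.Ioi (0 : ℝ), Real.exp (-(z ^ 2) / (2 * u) - u / 2)) *
          Real.exp (-γ * z)) ≤ C / γ ^ 2 := by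
  refine ⟨1 / 2, by norm_num, fun γ hγ => ?_⟩
  have hγ0 : 0 < γ := by linarith
  have hexp : ∫ u in Set.Ioi (0 : ℝ), Real.exp (-(1 / 2) * u) = 2 := by
    rw [integral_exp_mul_Ioi (by norm_num) 0]; norm_num
  have hexpi : IntegrableOn (fun u : ℝ => Real.exp (-(1 / 2) * u)) (Set.Ioi 0) :=
    integrableOn_exp_mul_Ioi (by norm_num) 0
  have hin : ∀ z : ℝ, (∫ u in Set.Ioi (0 : ℝ), Real.exp (-(z ^ 2) / (2 * u) - u / 2)) ≤ 2 := by
    intro z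
    refine le_of_le_of_eq ?_ hexp
    refine integral_mono_of_nonneg (Filter.Eventually.of_forall fun u => (Real.exp_pos _).le)
      hexpi ?_
    filter_upwards [ae_restrict_mem measurableSet_Ioi] with u hu
    have hu : 0 < u := hu
    apply Real.exp_le_exp.mpr
    have : 0 ≤ z ^ 2 / (2 * u) := by positivity
    rw [neg_div]
    linarith
  have hg : ∫ z in Set.Ioi (0 : ℝ), z ^ ((2 : ℝ) - 1) * Real.exp (-(γ * z)) = 1 / γ ^ 2 := by
    rw [Real.integral_rpow_mul_exp_neg_mul_Ioi (by norm_num) hγ0]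
    simp
  have hgi : Integrable (fun z : ℝ => z ^ ((2 : ℝ) - 1) * Real.exp (-(γ * z)))
      (volume.restrict (Set.Ioi 0)) := by
    apply Integrable.of_integral_ne_zero
    rw [hg]; positivity
  have hfin : (1 / 2 : ℝ) / γ ^ 2
      = ∫ z in Set.Ioi (0 : ℝ), (1 / 2) * (z ^ ((2 : ℝ) - 1) * Real.exp (-(γ * z))) := by
    rw [integral_const_mul, hg]; ring
  rw [hfin]
  refine integral_mono_of_nonneg ?_ (hgi.const_mul _) ?_
  · filter_upwards [ae_restrict_mem measurableSet_Ioi] with z hz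
    have hz : 0 < z := hz
    have : 0 ≤ ∫ u in Set.Ioi (0 : ℝ), Real.exp (-(z ^ 2) / (2 * u) - u / 2) :=
      integral_nonneg fun u => (Real.exp_pos _).le
    simp only [Pi.zero_apply]
    positivity
  · filter_upwards [ae_restrict_mem measurableSet_Ioi] with z hz
    have hz : 0 < z := hz
    have h1 : z ^ ((2 : ℝ) - 1) = z := by
      rw [show (2 : ℝ) - 1 = 1 by norm_num, Real.rpow_one]
    rw [h1, ← neg_mul, ← mul_assoc]
    apply mul_le_mul_of_nonneg_right _ (Real.exp_pos _).le
    have := mul_le_mul_of_nonneg_left (hin z) (by positivity : 0 ≤ z / 4)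
    linarith
end
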